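/- For every integer r ≥ 3 there exist positive constants c₁ = c₁(r) and c₂ = c₂(r) with the following property: for every convexity space (X, 𝒞) with Radon number at most r and every finite family F of convex sets of 𝒞, the transversal number satisfies τ(F) ≤ c₁ · (τ*(F))^{c₂}. -/

import Mathlib

open scoped Classical

/-- A convexity space on a ground set `X`: a finite family of "convex" subsets of `X`
containing `∅` and `X` and closed under pairwise intersections. -/
structure ConvexitySpace (X : Type*) where
  sets : Finset (Set X)
  empty_mem : ∅ ∈ sets
  univ_mem : Set.univ ∈ sets
  inter_mem : ∀ A ∈ sets, ∀ B ∈ sets, A ∩ B ∈ sets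

namespace ConvexitySpace

variable {X : Type*}

/-- The convex hull of `Y`: the intersection of all convex sets containing `Y`. -/
def hull (CS : ConvexitySpace X) (Y : Set X) : Set X :=
  ⋂₀ {S : Set X | S ∈ CS.sets ∧ Y ⊆ S}

/-- The convexity space has Radon number at most `r`: every set of at least `r` points
can be partitioned into two parts whose convex hulls intersect. -/
def RadonLE (CS : ConvexitySpace X) (r : ℕ) : Prop :=
  ∀ P : Finset X, r ≤ P.card →
    ∃ P₁ P₂ : Finset X, P₁ ∪ P₂ = P ∧ Disjoint P₁ P₂ ∧
      (CS.hull ↑P₁ ∩ CS.hull ↑P₂).Nonempty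

end ConvexitySpace

namespace ConvexitySpace

universe u
variable {X : Type u}

lemma subset_hull (CS : ConvexitySpace X) (Y : Set X) : Y ⊆ CS.hull Y :=
  fun _ hx _ hS => hS.2 hx

lemma hull_mono (CS : ConvexitySpace X) {Y Z : Set X} (h : Y ⊆ Z) : CS.hull Y ⊆ CS.hull Z :=
  fun _ hx S hS => hx S ⟨hS.1, h.trans hS.2⟩

lemma hull_hull (CS : ConvexitySpace X) {Y Z : Set X} (h : Y ⊆ CS.hull Z) :
    CS.hull Y ⊆ CS.hull Z :=
  fun _ hx S hS => hx S ⟨hS.1, fun _ hy => h hy S hS⟩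

lemma hull_min (CS : ConvexitySpace X) {Y S : Set X} (hS : S ∈ CS.sets) (h : Y ⊆ S) :
    CS.hull Y ⊆ S :=
  fun _ hx => hx S ⟨hS, h⟩

/-- Indexed Tverberg property. -/
def Tv (CS : ConvexitySpace X) (ι κ : Type) : Prop :=
  ∀ p : ι → X, ∃ φ : ι → κ, ∃ x, ∀ j, x ∈ CS.hull (p '' {q | φ q = j})

lemma tv_bool (CS : ConvexitySpace X) {r : ℕ} (h : CS.RadonLE r) : CS.Tv (Fin r) Bool := by
  intro p
  by_cases hp : Function.Injective p
  · obtain ⟨P₁, P₂, hu, hd, x, hx₁, hx₂⟩ := h (Finset.univ.image p)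
      (by rw [Finset.card_image_of_injective _ hp]; simp)
    have hmem : ∀ z, z ∈ P₁ ∪ P₂ → ∃ q, p q = z := by
      intro z hz
      rw [hu] at hz
      simpa using hz
    refine ⟨fun q => decide (p q ∈ P₁), x, ?_⟩
    intro j
    cases j
    · refine CS.hull_mono ?_ hx₂
      intro z hz
      obtain ⟨q, rfl⟩ := hmem z (Finset.mem_union_right _ hz)
      refine ⟨q, ?_, rfl⟩
      have : p q ∉ P₁ := fun h1 => (Finset.disjoint_left.mp hd h1) hz
      simpa using this
    · refine CS.hull_mono ?_ hx₁
      intro z hz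
      obtain ⟨q, rfl⟩ := hmem z (Finset.mem_union_left _ hz)
      refine ⟨q, ?_, rfl⟩
      simpa using hz
  · simp only [Function.Injective, not_forall] at hp
    obtain ⟨a, b, hab, hne⟩ := hp
    refine ⟨fun q => decide (q = a), p a, ?_⟩
    intro j
    apply CS.subset_hull
    cases j
    · exact ⟨b, by simpa using fun h : b = a => hne h.symm, hab.symm⟩
    · exact ⟨a, by simp, rfl⟩

lemma Tv.map {CS : ConvexitySpace X} {ι ι' κ κ' : Type} (h : CS.Tv ι κ) (e : ι → ι')
    (he : Function.Bijective e) (g : κ → κ') (hg : Function.Surjective g) : CS.Tv ι' κ' := by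
  intro p
  obtain ⟨φ, x, hx⟩ := h (p ∘ e)
  let E := Equiv.ofBijective e he
  refine ⟨fun i => g (φ (E.symm i)), x, ?_⟩
  intro j
  obtain ⟨j, rfl⟩ := hg j
  refine CS.hull_mono ?_ (hx j)
  rintro _ ⟨q, hq, rfl⟩
  refine ⟨e q, ?_, rfl⟩
  have : E.symm (e q) = q := E.symm_apply_apply q
  simp only [Set.mem_ofPred_eq] at hq ⊢
  rw [this, hq]

lemma Tv.prod {CS : ConvexitySpace X} {ι ι' κ κ' : Type} (h : CS.Tv ι κ) (h' : CS.Tv ι' κ') :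
    CS.Tv (ι × ι') (κ × κ') := by
  intro p
  choose φ z hz using fun i => h' (fun i' => p (i, i'))
  obtain ⟨ψ, x, hx⟩ := h z
  refine ⟨fun a => (ψ a.1, φ a.1 a.2), x, ?_⟩
  rintro ⟨j, j'⟩
  refine CS.hull_hull ?_ (hx j)
  rintro _ ⟨i, hi, rfl⟩
  refine CS.hull_mono ?_ (hz i j')
  rintro _ ⟨i', hi', rfl⟩
  refine ⟨(i, i'), ?_, rfl⟩
  simp only [Set.mem_ofPred_eq] at hi hi' ⊢
  rw [hi, hi']

lemma tv_pow (CS : ConvexitySpace X) [Nonempty X] {r : ℕ} (h : CS.RadonLE r) (s : ℕ) :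
    CS.Tv (Fin (r ^ s)) (Fin (2 ^ s)) := by
  induction s with
  | zero =>
    intro p
    refine ⟨fun _ => 0, p ⟨0, by simp⟩, ?_⟩
    intro j
    apply CS.subset_hull
    refine ⟨_, ?_, rfl⟩
    simp only [Set.mem_ofPred_eq]
    apply Fin.ext
    have := j.2
    simp at this ⊢
  | succ s ih =>
    have h2 := (ih.prod (CS.tv_bool h))
    refine h2.map (finProdFinEquiv.trans (finCongr (pow_succ r s).symm)) (Equiv.bijective _)
      ((Equiv.prodCongr (Equiv.refl _) finTwoEquiv.symm).trans
        (finProdFinEquiv.trans (finCongr (pow_succ 2 s).symm))) (Equiv.surjective _)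

/-- Tverberg property for an arbitrary finite nonempty colour type. -/
lemma tv_fintype (CS : ConvexitySpace X) [Nonempty X] {r : ℕ} (h : CS.RadonLE r) (κ : Type)
    [Fintype κ] [Nonempty κ] : CS.Tv (Fin (r ^ Fintype.card κ)) κ := by
  have : Nonempty (κ ↪ Fin (2 ^ Fintype.card κ)) := by
    apply Function.Embedding.nonempty_of_card_le
    simpa using Nat.lt_two_pow_self.le
  obtain ⟨e⟩ := this
  exact (CS.tv_pow h _).map id Function.bijective_id (Function.invFun e)
    (Function.invFun_surjective e.injective)

/-- Sets closed under taking hulls. -/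
def Cl (CS : ConvexitySpace X) (A : Set X) : Prop := ∀ Q ⊆ A, CS.hull Q ⊆ A

lemma cl_hull (CS : ConvexitySpace X) (Y : Set X) : CS.Cl (CS.hull Y) :=
  fun _ h => CS.hull_hull h

/-- Weak colourful Helly theorem. -/
lemma colorful {CS : ConvexitySpace X} {ι κ : Type} (h : CS.Tv ι κ)
    (A : (ι → κ) → κ → Set X) (hA : ∀ φ j, CS.Cl (A φ j))
    (ht : ∀ q, ∃ x, ∀ φ, x ∈ A φ (φ q)) : ∃ φ, ∃ x, ∀ j, x ∈ A φ j := by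
  choose p hp using ht
  obtain ⟨φ, x, hx⟩ := h p
  refine ⟨φ, x, fun j => hA φ j _ ?_ (hx j)⟩
  rintro _ ⟨q, hq, rfl⟩
  have := hp q φ
  rwa [hq] at this

/-- Helly's theorem. -/
lemma helly (CS : ConvexitySpace X) {r : ℕ} (h : CS.RadonLE r) {Ω : Type*}
    (A : Ω → Set X) (hA : ∀ ω, CS.Cl (A ω)) (G : Finset Ω) (hG : ¬ ∃ x, ∀ ω ∈ G, x ∈ A ω) :
    ∃ G' ⊆ G, (¬ ∃ x, ∀ ω ∈ G', x ∈ A ω) ∧ G'.card < r := by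
  induction G using Finset.strongInduction with
  | H G ih =>
  by_cases hc : G.card < r
  · exact ⟨G, subset_rfl, hG, hc⟩
  by_cases hm : ∃ ω ∈ G, ¬ ∃ x, ∀ ω' ∈ G.erase ω, x ∈ A ω'
  · obtain ⟨ω, hω, hb⟩ := hm
    obtain ⟨G', h1, h2⟩ := ih _ (Finset.erase_ssubset hω) hb
    exact ⟨G', h1.trans (Finset.erase_subset _ _), h2⟩
  exfalso
  push Not at hm hc
  choose p hp using hm
  have : Nonempty (Fin r ↪ G) := by
    apply Function.Embedding.nonempty_of_card_le
    simpa using hc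
  obtain ⟨e⟩ := this
  obtain ⟨φ, x, hx⟩ := CS.tv_bool h (fun q => p (e q) (e q).2)
  apply hG
  refine ⟨x, fun ω hω => ?_⟩
  have key : ∃ b, ∀ q, φ q = b → (e q : Ω) ≠ ω := by
    by_cases hq : ∃ q, (e q : Ω) = ω
    · obtain ⟨q, hq⟩ := hq
      refine ⟨!(φ q), fun q' hq' he => ?_⟩
      have : q' = q := e.injective (Subtype.ext (he.trans hq.symm))
      subst this
      simp at hq'
    · push Not at hq
      exact ⟨true, fun q _ => hq q⟩
  obtain ⟨b, hb⟩ := key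
  refine hA ω _ ?_ (hx b)
  rintro _ ⟨q, hq, rfl⟩
  exact hp _ _ ω (Finset.mem_erase.mpr ⟨(hb q hq).symm, hω⟩)

/-- If almost all tuples intersect then a point lies in half of the sets. -/
lemma half (CS : ConvexitySpace X) [Nonempty X] {r t : ℕ} (h : CS.RadonLE r)
    (hT : CS.Tv (Fin t) (Fin r)) {Ω : Type*} [Fintype Ω]
    (A : Ω → Set X) (hA : ∀ ω, CS.Cl (A ω))
    (hD : (Finset.univ.filter (fun y : (Fin t → Fin r) → Ω => ¬ ∃ x, ∀ φ, x ∈ A (y φ))).card *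
      (t * (2 * r) ^ Fintype.card (Fin t → Fin r)) <
        Fintype.card Ω ^ Fintype.card (Fin t → Fin r)) :
    ∃ x, Fintype.card Ω ≤ 2 * (Finset.univ.filter (fun ω => x ∈ A ω)).card := by
  by_contra hcon
  push Not at hcon
  let Bad : Finset Ω → Prop := fun G => (¬ ∃ x, ∀ ω ∈ G, x ∈ A ω) ∧ G.card < r
  let P : Finset (Finset Ω) → Prop := fun M => (∀ G ∈ M, Bad G) ∧
    (M : Set (Finset Ω)).PairwiseDisjoint id
  obtain ⟨M, hM⟩ : ∃ M, Maximal P M := by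
    obtain ⟨M, -, hM⟩ := Finite.exists_le_maximal (p := P) (a := ∅) (by simp [P])
    exact ⟨M, hM⟩
  obtain ⟨⟨hMb, hMd⟩, hMmax⟩ := hM
  have hne : ∀ G, Bad G → G.Nonempty := by
    intro G hG
    rw [Finset.nonempty_iff_ne_empty]
    rintro rfl
    exact hG.1 ⟨Classical.arbitrary X, by simp⟩
  set U := M.biUnion id with hU
  have hUc : ∃ x, ∀ ω ∈ Uᶜ, x ∈ A ω := by
    by_contra hc
    obtain ⟨G, hGU, hG⟩ := CS.helly h A hA _ hc
    have hdis : ∀ G' ∈ M, Disjoint G G' := by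
      intro G' hG'
      rw [Finset.disjoint_left]
      intro ω h1 h2
      have := hGU h1
      rw [Finset.mem_compl] at this
      exact this (Finset.mem_biUnion.mpr ⟨G', hG', h2⟩)
    have hP : P (insert G M) := by
      constructor
      · intro G' hG'
        rcases Finset.mem_insert.mp hG' with rfl | h'
        · exact hG
        · exact hMb _ h'
      · rw [Finset.coe_insert]
        apply hMd.insert
        intro j hj _
        exact hdis j hj
    have := hMmax hP (Finset.subset_insert _ _) (Finset.mem_insert_self _ _)
    have h3 := hdis G this
    rw [disjoint_self] at h3
    exact (hne G hG).ne_empty h3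
  obtain ⟨x, hx⟩ := hUc
  have h1 : Uᶜ.card ≤ (Finset.univ.filter (fun ω => x ∈ A ω)).card :=
    Finset.card_le_card (fun ω hω => by simpa using hx ω hω)
  have h2 := hcon x
  have h3 : U.card ≤ M.card * r := Finset.card_biUnion_le_card_mul _ _ _
    (fun G hG => (hMb G hG).2.le)
  have h4 : U.card + Uᶜ.card = Fintype.card Ω := Finset.card_add_card_compl U
  have h5 : Fintype.card Ω ≤ 2 * r * M.card := by nlinarith
  -- enumerations
  have hs : ∀ G : M, ∃ s : Fin r → Ω, ∀ ω, ω ∈ G.1 ↔ ∃ j, s j = ω := by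
    rintro ⟨G, hG⟩
    have : Nonempty (G ↪ Fin r) := by
      apply Function.Embedding.nonempty_of_card_le
      simpa using (hMb G hG).2.le
    obtain ⟨e⟩ := this
    have : Nonempty G := (hne G (hMb G hG)).to_subtype
    refine ⟨fun j => (Function.invFun e j : G), fun ω => ⟨fun hω => ?_, ?_⟩⟩
    · obtain ⟨j, hj⟩ := Function.invFun_surjective e.injective ⟨ω, hω⟩
      exact ⟨j, by simp [hj]⟩
    · rintro ⟨j, rfl⟩
      exact (Function.invFun e j : G).2
  choose s hs using hs
  have hsinj : ∀ j, Function.Injective (fun G => s G j) := by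
    intro j G G' hGG
    simp only at hGG
    by_contra hn
    have hd := hMd G.2 G'.2 (fun hh => hn (Subtype.ext hh))
    exact Finset.disjoint_left.mp hd ((hs G _).mpr ⟨j, rfl⟩) ((hs G' _).mpr ⟨j, hGG.symm⟩)
  set D := (Finset.univ.filter
    (fun y : (Fin t → Fin r) → Ω => ¬ ∃ x, ∀ φ, x ∈ A (y φ))) with hDdef
  let B : Fin t → Finset ((Fin t → Fin r) → M) := fun q =>
    Finset.univ.filter (fun m => ¬ ∃ x, ∀ φ, x ∈ A (s (m φ) (φ q)))
  have hB : ∀ q, (B q).card ≤ D.card := by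
    intro q
    apply Finset.card_le_card_of_injOn (fun m φ => s (m φ) (φ q))
    · intro m hm
      simpa [B, hDdef] using hm
    · intro m _ m' _ hmm
      funext φ
      exact hsinj (φ q) (congrFun hmm φ)
  have hex : ∃ m : (Fin t → Fin r) → M, ∀ q, m ∉ B q := by
    by_contra hc
    push Not at hc
    have hcov : (Finset.univ : Finset ((Fin t → Fin r) → M)) ⊆ Finset.univ.biUnion B := by
      intro m _
      obtain ⟨q, hq⟩ := hc m
      exact Finset.mem_biUnion.mpr ⟨q, Finset.mem_univ _, hq⟩
    have hle := (Finset.card_le_card hcov).trans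
      (Finset.card_biUnion_le_card_mul _ _ _ (fun q _ => hB q))
    rw [Finset.card_univ, Fintype.card_fun, Fintype.card_coe, Finset.card_univ,
      Fintype.card_fin] at hle
    have h6 := Nat.pow_le_pow_left h5 (Fintype.card (Fin t → Fin r))
    rw [mul_pow] at h6
    have h7 := Nat.mul_le_mul_left ((2 * r) ^ Fintype.card (Fin t → Fin r)) hle
    have h8 : (2 * r) ^ Fintype.card (Fin t → Fin r) * (t * D.card) =
      D.card * (t * (2 * r) ^ Fintype.card (Fin t → Fin r)) := by ring
    omega
  obtain ⟨m, hm⟩ := hex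
  obtain ⟨φ, x, hx⟩ := colorful hT (fun φ j => A (s (m φ) j)) (fun φ j => hA _) (by
    intro q
    have := hm q
    simpa [B] using this)
  refine (hMb _ (m φ).2).1 ⟨x, fun ω hω => ?_⟩
  obtain ⟨j, rfl⟩ := (hs (m φ) ω).mp hω
  exact hx j

/-- Random tuples have intersecting hulls with positive probability. -/
lemma chunk (CS : ConvexitySpace X) {Φ : Type} [Fintype Φ] [Nonempty Φ] {t : ℕ}
    (hT : CS.Tv (Fin t) Φ) {V : Type*} [Fintype V] (p : V → X) :
    Fintype.card (Fin t → Φ → V) ≤ Fintype.card (Fin t → Φ) *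
      (Finset.univ.filter (fun y : Fin t → Φ → V =>
        ∃ x, ∀ φ, x ∈ CS.hull (Set.range fun s => p (y s φ)))).card := by
  set G := (Finset.univ.filter (fun y : Fin t → Φ → V =>
        ∃ x, ∀ φ, x ∈ CS.hull (Set.range fun s => p (y s φ)))) with hG
  let φ0 : Φ := Classical.arbitrary Φ
  let F : (Fin t → Φ) × (Fin t → Φ → V) → (Fin t → Φ → V) :=
    fun a s φ => a.2 s (Equiv.swap φ0 (a.1 s) φ)
  have hcov : (Finset.univ : Finset (Fin t → Φ → V)) ⊆
      ((Finset.univ : Finset (Fin t → Φ)) ×ˢ G).image F := by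
    intro y _
    obtain ⟨ψ, x, hx⟩ := hT (fun s => p (y s φ0))
    rw [Finset.mem_image]
    refine ⟨(ψ, F (ψ, y)), ?_, ?_⟩
    · simp only [Finset.mem_product, Finset.mem_univ, true_and, hG, Finset.mem_filter]
      refine ⟨x, fun φ => CS.hull_mono ?_ (hx φ)⟩
      rintro _ ⟨s, hs, rfl⟩
      simp only [Set.mem_ofPred_eq] at hs
      subst hs
      exact ⟨s, by simp [F]⟩
    · funext s φ
      simp [F]
  have := (Finset.card_le_card hcov).trans Finset.card_image_le
  rwa [Finset.card_univ, Finset.card_product, Finset.card_univ] at this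

lemma arith (K K0 : ℕ) (h0 : 0 < K0) : ∃ c : ℕ, K * (K0 - 1) ^ c < K0 ^ c := by
  have hpos : (0 : ℝ) < K0 := by exact_mod_cast h0
  have h1 : ((K0 - 1 : ℕ) : ℝ) / K0 < 1 := by
    rw [div_lt_one hpos]
    exact_mod_cast Nat.sub_lt h0 one_pos
  obtain ⟨c, hc⟩ := exists_pow_lt_of_lt_one (show (0 : ℝ) < 1 / (K + 1) by positivity) h1
  refine ⟨c, ?_⟩
  rw [div_pow, div_lt_div_iff₀ (by positivity) (by positivity)] at hc
  have h2 : ((K0 - 1 : ℕ) : ℝ) ^ c * (K + 1) < K0 ^ c := by linarith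
  have h3 : (K0 - 1) ^ c * (K + 1) < K0 ^ c := by exact_mod_cast h2
  nlinarith [Nat.zero_le ((K0 - 1) ^ c)]

lemma count_arith {K K0 c d g g' n : ℕ} (h0 : 0 < K0) (hc : K * (K0 - 1) ^ c < K0 ^ c)
    (hn : 0 < n) (hg : g + g' = n) (hch : n ≤ K0 * g) (hd : d ≤ g' ^ c) : d * K < n ^ c := by
  have hfail : K0 * g' ≤ (K0 - 1) * n := by
    obtain ⟨k, rfl⟩ : ∃ k, K0 = k + 1 := ⟨K0 - 1, by omega⟩
    simp only [Nat.add_sub_cancel]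
    nlinarith
  have e1 : K0 ^ c * d ≤ (K0 - 1) ^ c * n ^ c := by
    calc K0 ^ c * d ≤ K0 ^ c * g' ^ c := Nat.mul_le_mul_left _ hd
      _ = (K0 * g') ^ c := (mul_pow _ _ _).symm
      _ ≤ ((K0 - 1) * n) ^ c := Nat.pow_le_pow_left hfail c
      _ = _ := mul_pow _ _ _
  have e2 : K0 ^ c * (d * K) < K0 ^ c * n ^ c := by
    calc K0 ^ c * (d * K) = K * (K0 ^ c * d) := by ring
      _ ≤ K * ((K0 - 1) ^ c * n ^ c) := Nat.mul_le_mul_left _ e1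
      _ = (K * (K0 - 1) ^ c) * n ^ c := by ring
      _ < K0 ^ c * n ^ c := Nat.mul_lt_mul_of_pos_right hc (pow_pos hn c)
  exact Nat.lt_of_mul_lt_mul_left e2

lemma count_bad {X : Type u} (CS : ConvexitySpace X) {Φ : Type} [Fintype Φ] [Nonempty Φ]
    {t c K : ℕ} (hT2 : CS.Tv (Fin t) Φ)
    (hc : K * (Fintype.card (Fin t → Φ) - 1) ^ c < Fintype.card (Fin t → Φ) ^ c)
    (V : Type u) [Fintype V] [Nonempty V] (p : V → X) :
    (Finset.univ.filter (fun y : Φ → Fin c × Fin t → V =>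
      ¬ ∃ x, ∀ φ, x ∈ CS.hull (Set.range (p ∘ y φ)))).card * K <
    Fintype.card (Fin c × Fin t → V) ^ Fintype.card Φ := by
  have hch := CS.chunk hT2 p
  set D := (Finset.univ.filter (fun y : Φ → Fin c × Fin t → V =>
    ¬ ∃ x, ∀ φ, x ∈ CS.hull (Set.range (p ∘ y φ)))) with hDdef
  set G := (Finset.univ.filter (fun y : Fin t → Φ → V =>
        ∃ x, ∀ φ, x ∈ CS.hull (Set.range fun s => p (y s φ)))) with hG
  have hDle : D.card ≤ Gᶜ.card ^ c := by
    have : (Fintype.piFinset (fun _ : Fin c => Gᶜ)).card = Gᶜ.card ^ c := by simp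
    rw [← this]
    apply Finset.card_le_card_of_injOn (fun y a s φ => y φ (a, s))
    · intro y hy
      simp only [hDdef, Finset.coe_filter, Finset.mem_univ, true_and, Set.mem_ofPred_eq] at hy
      simp only [Finset.mem_coe, Fintype.mem_piFinset, Finset.mem_compl, hG, Finset.mem_filter,
        Finset.mem_univ, true_and]
      rintro a ⟨x, hx⟩
      refine hy ⟨x, fun φ => CS.hull_mono ?_ (hx φ)⟩
      rintro _ ⟨s, rfl⟩
      exact ⟨(a, s), rfl⟩
    · intro y _ y' _ hyy
      funext φ ⟨a, s⟩
      exact congrFun (congrFun (congrFun hyy a) s) φ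
  have htot : Fintype.card (Fin c × Fin t → V) ^ Fintype.card Φ = Fintype.card (Fin t → Φ → V) ^ c := by
    rw [Fintype.card_fun, Fintype.card_fun, Fintype.card_fun, Fintype.card_prod, Fintype.card_fin, Fintype.card_fin, ← pow_mul, ← pow_mul,
      ← pow_mul]
    congr 1
    ring
  rw [htot]
  exact count_arith Fintype.card_pos hc Fintype.card_pos (Finset.card_add_card_compl G) hch hDle

lemma selection (r : ℕ) (hr : 3 ≤ r) : ∃ c t : ℕ, ∀ (X : Type u) (_ : Nonempty X)
    (CS : ConvexitySpace X), CS.RadonLE r → ∀ (V : Type u) (_ : Fintype V) (_ : Nonempty V)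
      (p : V → X), ∃ x, Fintype.card V ^ (c * t) ≤ 2 * (Finset.univ.filter
        (fun y : Fin c × Fin t → V => x ∈ CS.hull (Set.range (p ∘ y)))).card := by
  have : NeZero r := ⟨by omega⟩
  obtain ⟨T, hT⟩ : ∃ T, T = r ^ Fintype.card (Fin r) := ⟨_, rfl⟩
  obtain ⟨t, ht⟩ : ∃ t, t = r ^ Fintype.card (Fin T → Fin r) := ⟨_, rfl⟩
  obtain ⟨c, hc⟩ := arith (T * (2 * r) ^ Fintype.card (Fin T → Fin r))
    (Fintype.card (Fin t → Fin T → Fin r)) Fintype.card_pos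
  refine ⟨c, t, ?_⟩
  intro X _ CS hR V _ _ p
  have hT1 : CS.Tv (Fin T) (Fin r) := by
    rw [hT]
    exact CS.tv_fintype hR (Fin r)
  have hT2 : CS.Tv (Fin t) (Fin T → Fin r) := by
    rw [ht]
    exact CS.tv_fintype hR (Fin T → Fin r)
  have hcard : Fintype.card (Fin c × Fin t → V) = Fintype.card V ^ (c * t) := by simp
  rw [← hcard]
  refine CS.half hR hT1 (fun y : Fin c × Fin t → V => CS.hull (Set.range (p ∘ y)))
    (fun y => CS.cl_hull _) ?_
  clear hT ht
  convert CS.count_bad hT2 hc V p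

end ConvexitySpace

namespace ConvexitySpace

universe v

/-- Greedy construction of the transversal. -/
lemma greedy {X : Type v} (CS : ConvexitySpace X) {c t : ℕ}
    (hsel : ∀ (V : Type v) (_ : Fintype V) (_ : Nonempty V)
      (p : V → X), ∃ x, Fintype.card V ^ (c * t) ≤ 2 * (Finset.univ.filter
        (fun y : Fin c × Fin t → V => x ∈ CS.hull (Set.range (p ∘ y)))).card)
    (F : Finset (Set X)) (hF : ∀ S ∈ F, S ∈ CS.sets) (Y : Type v) [Fintype Y] (p : Y → X)
    (N : ℕ) (hN : 0 < N) (hS : ∀ S ∈ F, N ≤ Fintype.card {y : Y // p y ∈ S}) :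
    ∃ T : Finset X, (∀ S ∈ F, ∃ x ∈ T, x ∈ S) ∧
      T.card * N ^ (c * t) ≤ 2 * Fintype.card Y ^ (c * t) := by
  let Hit : Finset X → Finset (Fin c × Fin t → Y) := fun T =>
    Finset.univ.filter (fun y => ∃ x ∈ T, x ∈ CS.hull (Set.range (p ∘ y)))
  have hHit : ∀ T, (Hit T).card ≤ Fintype.card Y ^ (c * t) := by
    intro T
    have := Finset.card_le_univ (Hit T)
    simpa using this
  let Q : Finset X → Prop := fun T => T.card * N ^ (c * t) ≤ 2 * (Hit T).card
  have main : ∀ n : ℕ, (∃ T, Q T ∧ n ≤ T.card) ∨ ∃ T, Q T ∧ ∀ S ∈ F, ∃ x ∈ T, x ∈ S := by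
    intro n
    induction n with
    | zero => exact Or.inl ⟨∅, by simp [Q], by simp⟩
    | succ n ih =>
      rcases ih with ⟨T, hQ, hn⟩ | h
      swap
      · exact Or.inr h
      by_cases htr : ∀ S ∈ F, ∃ x ∈ T, x ∈ S
      · exact Or.inr ⟨T, hQ, htr⟩
      left
      push Not at htr
      obtain ⟨S, hSF, hST⟩ := htr
      have hcardS := hS S hSF
      have hne : Nonempty {y : Y // p y ∈ S} := Fintype.card_pos_iff.mp (by omega)
      obtain ⟨x, hx⟩ := hsel {y : Y // p y ∈ S} inferInstance hne (fun y => p y.1)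
      set Z := (Finset.univ.filter (fun y : Fin c × Fin t → {y : Y // p y ∈ S} =>
        x ∈ CS.hull (Set.range ((fun y : {y : Y // p y ∈ S} => p y.1) ∘ y)))) with hZ
      have hsub : ∀ y : Fin c × Fin t → {y : Y // p y ∈ S},
          CS.hull (Set.range ((fun y : {y : Y // p y ∈ S} => p y.1) ∘ y)) ⊆ S := by
        intro y
        apply CS.hull_min (hF S hSF)
        rintro _ ⟨i, rfl⟩
        exact (y i).2
      have hNZ : N ^ (c * t) ≤ 2 * Z.card := (Nat.pow_le_pow_left hcardS _).trans hx
      have hxS : x ∈ S := by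
        have : 0 < Z.card := by
          have := pow_pos hN (c * t)
          omega
        obtain ⟨y, hy⟩ := Finset.card_pos.mp this
        exact hsub y (Finset.mem_filter.mp hy).2
      have hxT : x ∉ T := fun h => hST x h hxS
      let emb : (Fin c × Fin t → {y : Y // p y ∈ S}) → (Fin c × Fin t → Y) := fun y i => (y i).1
      have hemb : Function.Injective emb := by
        intro y y' h
        funext i
        exact Subtype.ext (congrFun h i)
      have hdisj : Disjoint (Hit T) (Z.image emb) := by
        rw [Finset.disjoint_left]
        intro y hy hy'
        obtain ⟨z, hz, rfl⟩ := Finset.mem_image.mp hy'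
        obtain ⟨x', hx', hx''⟩ := (Finset.mem_filter.mp hy).2
        exact hST x' hx' (hsub z hx'')
      have hunion : Hit T ∪ Z.image emb ⊆ Hit (insert x T) := by
        intro y hy
        rcases Finset.mem_union.mp hy with hy | hy
        · obtain ⟨x', hx', hx''⟩ := (Finset.mem_filter.mp hy).2
          exact Finset.mem_filter.mpr ⟨Finset.mem_univ _, x', Finset.mem_insert_of_mem hx', hx''⟩
        · obtain ⟨z, hz, rfl⟩ := Finset.mem_image.mp hy
          exact Finset.mem_filter.mpr ⟨Finset.mem_univ _, x, Finset.mem_insert_self _ _,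
            (Finset.mem_filter.mp hz).2⟩
      have hle := Finset.card_le_card hunion
      rw [Finset.card_union_of_disjoint hdisj, Finset.card_image_of_injective _ hemb] at hle
      refine ⟨insert x T, ?_, ?_⟩
      · simp only [Q] at hQ ⊢
        rw [Finset.card_insert_of_notMem hxT]
        nlinarith
      · rw [Finset.card_insert_of_notMem hxT]
        omega
  rcases main (2 * Fintype.card Y ^ (c * t) + 1) with ⟨T, hQ, hn⟩ | ⟨T, hQ, hT⟩
  · exfalso
    have h1 := hHit T
    have h2 : T.card ≤ T.card * N ^ (c * t) := Nat.le_mul_of_pos_right _ (pow_pos hN _)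
    simp only [Q] at hQ
    omega
  · exact ⟨T, hT, hQ.trans (Nat.mul_le_mul_left _ (hHit T))⟩

end ConvexitySpace

theorem transversal_bound_convexity_spaces (r : ℕ) (hr : 3 ≤ r) :
    ∃ c₁ c₂ : ℝ, 0 < c₁ ∧ 0 < c₂ ∧
      ∀ (X : Type*) (_ : Nonempty X) (CS : ConvexitySpace X), CS.RadonLE r →
        ∀ F : Finset (Set X), (∀ S ∈ F, S ∈ CS.sets) →
          ∀ (W : Finset X) (f : X → ℝ),
            (∀ x, 0 ≤ f x ∧ f x ≤ 1) →
            (∀ x ∉ W, f x = 0) →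
            (∀ S ∈ F, 1 ≤ ∑ x ∈ W.filter (· ∈ S), f x) →
            ∃ T : Finset X, (∀ S ∈ F, ∃ x ∈ T, x ∈ S) ∧
              (T.card : ℝ) ≤ c₁ * (∑ x ∈ W, f x) ^ c₂ := by
  obtain ⟨c, t, hsel⟩ := ConvexitySpace.selection r hr
  refine ⟨2 * 2 ^ (c * t), ((c * t + 1 : ℕ) : ℝ), by positivity, by positivity, ?_⟩
  intro X hX CS hR F hF W f hf _ hfS
  set τ := ∑ x ∈ W, f x with hτ
  have hτ0 : 0 ≤ τ := Finset.sum_nonneg (fun x _ => (hf x).1)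
  rcases F.eq_empty_or_nonempty with rfl | ⟨S₀, hS₀⟩
  · exact ⟨∅, by simp, by simpa using by positivity⟩
  have hτ1 : 1 ≤ τ := (hfS S₀ hS₀).trans
    (Finset.sum_le_sum_of_subset_of_nonneg (Finset.filter_subset _ _) (fun x _ _ => (hf x).1))
  set N : ℕ := W.card + 1 with hNdef
  let g : X → ℕ := fun x => ⌈(N : ℝ) * f x⌉₊
  let Y := Σ x : W, Fin (g x)
  let p : Y → X := fun y => y.1
  have hY : (Fintype.card Y : ℝ) ≤ 2 * N * τ := by
    have h1 : Fintype.card Y = ∑ x ∈ W, g x := by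
      simp only [Y, Fintype.card_sigma, Fintype.card_fin]
      exact Finset.sum_coe_sort W g
    rw [h1, Nat.cast_sum]
    have h2 : ∑ x ∈ W, (g x : ℝ) ≤ ∑ x ∈ W, ((N : ℝ) * f x + 1) :=
      Finset.sum_le_sum (fun x _ =>
        (Nat.ceil_lt_add_one (mul_nonneg (Nat.cast_nonneg _) (hf x).1)).le)
    rw [Finset.sum_add_distrib, ← Finset.mul_sum] at h2
    simp only [Finset.sum_const, nsmul_eq_mul, mul_one] at h2
    have h3 : (W.card : ℝ) ≤ N := by exact_mod_cast Nat.le_succ _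
    have h4 : (N : ℝ) ≤ N * τ := le_mul_of_one_le_right (Nat.cast_nonneg _) hτ1
    linarith
  have hSN : ∀ S ∈ F, N ≤ Fintype.card {y : Y // p y ∈ S} := by
    intro S hS
    have h1 : ∑ x ∈ W.filter (· ∈ S), g x ≤ Fintype.card {y : Y // p y ∈ S} := by
      rw [← Finset.sum_coe_sort]
      have : Fintype.card (Σ x : {x // x ∈ W.filter (· ∈ S)}, Fin (g x)) ≤
          Fintype.card {y : Y // p y ∈ S} := by
        apply Fintype.card_le_of_injective
          (fun a => ⟨⟨⟨a.1.1, (Finset.mem_filter.mp a.1.2).1⟩, a.2⟩,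
            (Finset.mem_filter.mp a.1.2).2⟩)
        rintro ⟨⟨x, hx⟩, i⟩ ⟨⟨x', hx'⟩, i'⟩ h
        obtain ⟨h1, h2⟩ := Sigma.mk.inj_iff.mp (Subtype.mk.inj h)
        have h3 := Subtype.mk.inj h1
        simp only at h3
        subst h3
        have h4 := eq_of_heq h2
        simp only at h4
        rw [h4]
      simpa [Fintype.card_sigma] using this
    refine le_trans ?_ h1
    have h2 : (N : ℝ) ≤ ∑ x ∈ W.filter (· ∈ S), (g x : ℝ) := by
      calc (N : ℝ) ≤ N * ∑ x ∈ W.filter (· ∈ S), f x :=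
            le_mul_of_one_le_right (Nat.cast_nonneg _) (hfS S hS)
        _ = ∑ x ∈ W.filter (· ∈ S), N * f x := Finset.mul_sum _ _ _
        _ ≤ _ := Finset.sum_le_sum (fun x _ => Nat.le_ceil _)
    exact_mod_cast h2
  obtain ⟨T, hT, hTc⟩ := CS.greedy (hsel X hX CS hR) F hF Y p N (Nat.succ_pos _) hSN
  refine ⟨T, hT, ?_⟩
  rw [Real.rpow_natCast]
  have hNpos : (0 : ℝ) < (N : ℝ) ^ (c * t) := by
    have : (0 : ℝ) < N := by exact_mod_cast Nat.succ_pos _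
    positivity
  have h1 : (T.card : ℝ) * (N : ℝ) ^ (c * t) ≤ 2 * (Fintype.card Y : ℝ) ^ (c * t) := by
    exact_mod_cast hTc
  have h2 : (Fintype.card Y : ℝ) ^ (c * t) ≤ (2 * N * τ) ^ (c * t) :=
    pow_le_pow_left₀ (Nat.cast_nonneg _) hY _
  rw [mul_pow, mul_pow] at h2
  have h3 : τ ^ (c * t) ≤ τ ^ (c * t + 1) := pow_le_pow_right₀ hτ1 (Nat.le_succ _)
  have h4 : (T.card : ℝ) * (N : ℝ) ^ (c * t) ≤
      (2 * 2 ^ (c * t) * τ ^ (c * t)) * (N : ℝ) ^ (c * t) := by nlinarith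
  have h5 := le_of_mul_le_mul_right h4 hNpos
  exact h5.trans (mul_le_mul_of_nonneg_left h3 (by positivity))
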